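/- There is a constant c > 0 such that for every n = 2^k with k ≥ 2 a power of 2, every strong probabilistic formula computing the indirect storage access function ISA_n with bounded error has size at least c·n²/log₂ n. -/

import Mathlib

open scoped ENNReal

/-- A Boolean formula over variables `V`. -/
inductive BFormula (V : Type) : Type
  | var : V → BFormula V
  | const : Bool → BFormula V
  | node : (Bool → Bool → Bool) → BFormula V → BFormula V → BFormula V

namespace BFormula

/-- Evaluation of a formula on an assignment. -/
def eval {V : Type} (x : V → Bool) : BFormula V → Bool
  | var v => x v
  | const b => b
  | node g l r => g (eval x l) (eval x r)

/-- Number of leaves labeled by a variable satisfying `P`. -/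
def sizeP {V : Type} (P : V → Bool) : BFormula V → ℕ
  | var v => if P v then 1 else 0
  | const _ => 0
  | node _ l r => sizeP P l + sizeP P r

/-- Number of leaves labeled by variables. -/
def size {V : Type} (F : BFormula V) : ℕ := sizeP (fun _ => true) F

end BFormula

/-- Expected size of a strong probabilistic formula (distribution on formulas). -/
noncomputable def pmfSize {V : Type} (p : PMF (BFormula V)) : ℝ≥0∞ :=
  ∑' F, p F * (F.size : ℝ≥0∞)

/-- A strong probabilistic formula computes `f` with bounded error (2/3). -/
def ComputesBdd {V : Type} (p : PMF (BFormula V)) (f : (V → Bool) → Bool) : Prop :=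
  ∀ x : V → Bool, 2/3 ≤ ∑' F, (if F.eval x = f x then p F else 0)

/-- Alice's inputs in the `i`-th communication game: variables outside block `i`. -/
def AliceT {n k : ℕ} (y : Fin n → Fin k) (i : Fin k) : Type := {j : Fin n // y j ≠ i} → Bool
/-- Bob's inputs in the `i`-th communication game: variables in block `i`. -/
def BobT {n k : ℕ} (y : Fin n → Fin k) (i : Fin k) : Type := {j : Fin n // y j = i} → Bool

/-- Combining Alice's and Bob's inputs to a full input. -/
def combine {n k : ℕ} (y : Fin n → Fin k) (i : Fin k)
    (a : AliceT y i) (b : BobT y i) : Fin n → Bool :=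
  fun j => if h : y j = i then b ⟨j, h⟩ else a ⟨j, h⟩

/-- The `i`-th communication game induced by `f` and the partition `y`. -/
def game {n k : ℕ} (f : (Fin n → Bool) → Bool) (y : Fin n → Fin k) (i : Fin k) :
    AliceT y i → BobT y i → Bool :=
  fun a b => f (combine y i a b)

/-- Deterministic one-way communication complexity. -/
noncomputable def Dcc {A B : Type} (g : A → B → Bool) : ℕ :=
  sInf {c : ℕ | ∃ M : A → Fin (2^c), ∃ o : Fin (2^c) → B → Bool, ∀ a b, o (M a) b = g a b}

/-- `S` is shattered by the rows of `g`. -/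
def Shatters {A B : Type} (g : A → B → Bool) (S : Finset B) : Prop :=
  ∀ R ⊆ S, ∃ a : A, ∀ b ∈ S, (g a b = true ↔ b ∈ R)

/-- VC-dimension of the two-party problem `g`. -/
noncomputable def VCdim {A B : Type} (g : A → B → Bool) : ℕ :=
  sSup {d : ℕ | ∃ S : Finset B, Shatters g S ∧ S.card = d}
/-- The number encoded in binary by the bits `b`. -/
def binVal (m : ℕ) (b : Fin m → Bool) : ℕ :=
  ∑ i : Fin m, if b i then 2 ^ (i : ℕ) else 0

/-- Variables of the indirect storage access function for `n = 2^k`, `k = 2^j`: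
the address block `U` of length `log₂ n - log₂ log₂ n = k - j`, and the blocks
`X` and `Y` of length `n` each. -/
abbrev ISAVar (k j : ℕ) : Type := Fin (k - j) ⊕ Fin (2 ^ k) ⊕ Fin (2 ^ k)

/-- The indirect storage access function `ISA(U,X,Y) = Y_{X_U}` for `n = 2^k`:
`U` addresses the `u`-th block of `log₂ n = k` consecutive bits of `X`, which in
turn addresses a bit of `Y`. (All indices are in range when `k = 2^j`; reduction
mod `n` then does not change them.) -/
def ISA (k j : ℕ) (x : ISAVar k j → Bool) : Bool :=
  let n := 2 ^ k
  let u : ℕ := binVal (k - j) (fun i => x (Sum.inl i))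
  let v : ℕ := binVal k
    (fun i => x (Sum.inr (Sum.inl ⟨(u * k + (i : ℕ)) % n, Nat.mod_lt _ (Nat.two_pow_pos k)⟩)))
  x (Sum.inr (Sum.inr ⟨v % n, Nat.mod_lt _ (Nat.two_pow_pos k)⟩))

namespace BFormula

/-- A formula without leaves in `P` takes the same value on assignments that agree outside `P`. -/
lemma eval_eq_of_sizeP_eq_zero {V : Type} {P : V → Bool} {x x' : V → Bool}
    (h : ∀ v, P v = false → x v = x' v) (F : BFormula V) (hF : F.sizeP P = 0) :
    F.eval x = F.eval x' := by
  induction F with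
  | var v =>
    refine h v ?_
    by_contra hv
    simp [sizeP, hv] at hF
  | const b => rfl
  | node g l r ihl ihr =>
    simp only [sizeP, Nat.add_eq_zero_iff] at hF
    simp only [eval, ihl hF.1, ihr hF.2]

/-- Nechiporuk's count of subfunctions, closed under composition with unary functions. -/
lemma exists_subfunctions_unary {V Θ ι : Type} [Fintype ι] [DecidableEq ι] {P : V → Bool}
    {a : Θ → ι → V → Bool}
    (h₁ : ∀ θ i i' v, P v = false → a θ i v = a θ i' v)
    (h₂ : ∀ θ θ' i v, P v = true → a θ i v = a θ' i v)
    (F : BFormula V) (hF : F.sizeP P ≠ 0) :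
    ∃ H : Finset (ι → Bool), (∀ θ (φ : Bool → Bool), (fun i => φ (F.eval (a θ i))) ∈ H) ∧
      4 * H.card ≤ 16 ^ F.sizeP P := by
  classical
  induction F with
  | var v =>
    have hv : P v = true := by
      by_contra hv
      simp [sizeP, hv] at hF
    rcases isEmpty_or_nonempty Θ with hΘ | ⟨⟨θ₀⟩⟩
    · exact ⟨∅, fun θ => hΘ.elim θ, by simp⟩
    refine ⟨Finset.univ.image fun φ : Bool → Bool => fun i => φ (a θ₀ i v), ?_, ?_⟩
    · intro θ φ
      refine Finset.mem_image.2 ⟨φ, Finset.mem_univ _, ?_⟩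
      funext i
      simp only [eval, h₂ θ θ₀ i v hv]
    · have := Finset.card_image_le (s := Finset.univ)
        (f := fun φ : Bool → Bool => fun i => φ (a θ₀ i v))
      have hc : (Finset.univ : Finset (Bool → Bool)).card = 4 := by decide
      simp only [sizeP, hv, if_true]
      omega
  | const b => exact absurd rfl hF
  | node g l r ihl ihr =>
    rcases isEmpty_or_nonempty ι with hι | ⟨⟨i₀⟩⟩
    · refine ⟨Finset.univ, fun _ _ => Finset.mem_univ _, ?_⟩
      have : 16 ^ 1 ≤ 16 ^ (node g l r).sizeP P :=
        Nat.pow_le_pow_right (by norm_num) (Nat.one_le_iff_ne_zero.2 hF)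
      simp only [Finset.card_univ, Fintype.card_pi, Fintype.card_bool, Finset.prod_const,
        Fintype.card_eq_zero, pow_zero]
      omega
    by_cases hl : l.sizeP P = 0
    · have hr : r.sizeP P ≠ 0 := by
        intro hr
        simp [sizeP, hl, hr] at hF
      obtain ⟨H, hH, hc⟩ := ihr hr
      refine ⟨H, fun θ φ => ?_, by simpa [sizeP, hl] using hc⟩
      convert hH θ fun b => φ (g (l.eval (a θ i₀)) b) using 2 with i
      simp only [eval, eval_eq_of_sizeP_eq_zero (h₁ θ i i₀) l hl]
    by_cases hr : r.sizeP P = 0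
    · obtain ⟨H, hH, hc⟩ := ihl hl
      refine ⟨H, fun θ φ => ?_, by simpa [sizeP, hr] using hc⟩
      convert hH θ fun b => φ (g b (r.eval (a θ i₀))) using 2 with i
      simp only [eval, eval_eq_of_sizeP_eq_zero (h₁ θ i i₀) r hr]
    obtain ⟨Hl, hHl, hcl⟩ := ihl hl
    obtain ⟨Hr, hHr, hcr⟩ := ihr hr
    let comb : (Bool → Bool) × (ι → Bool) × (ι → Bool) → ι → Bool :=
      fun t i => t.1 (g (t.2.1 i) (t.2.2 i))
    refine ⟨((Finset.univ : Finset (Bool → Bool)) ×ˢ Hl ×ˢ Hr).image comb, ?_, ?_⟩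
    · intro θ φ
      refine Finset.mem_image.2 ⟨(φ, fun i => l.eval (a θ i), fun i => r.eval (a θ i)), ?_, rfl⟩
      simp only [Finset.mem_product, Finset.mem_univ, true_and]
      exact ⟨hHl θ id, hHr θ id⟩
    · have hc : (Finset.univ : Finset (Bool → Bool)).card = 4 := by decide
      calc 4 * (((Finset.univ : Finset (Bool → Bool)) ×ˢ Hl ×ˢ Hr).image comb).card
          ≤ 4 * (4 * (Hl.card * Hr.card)) := by
            refine Nat.mul_le_mul_left _ (Finset.card_image_le.trans ?_)
            rw [Finset.card_product, Finset.card_product, hc]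
        _ = (4 * Hl.card) * (4 * Hr.card) := by ring
        _ ≤ 16 ^ l.sizeP P * 16 ^ r.sizeP P := Nat.mul_le_mul hcl hcr
        _ = 16 ^ (node g l r).sizeP P := by rw [sizeP, pow_add]

/-- A formula with `s` leaves in `P` has at most `2 ^ (4 * s + 1)` subfunctions on `P`. -/
lemma exists_subfunctions {V Θ ι : Type} [Fintype ι] [DecidableEq ι] {P : V → Bool}
    {a : Θ → ι → V → Bool}
    (h₁ : ∀ θ i i' v, P v = false → a θ i v = a θ i' v)
    (h₂ : ∀ θ θ' i v, P v = true → a θ i v = a θ' i v) (F : BFormula V) :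
    ∃ H : Finset (ι → Bool), (∀ θ, (fun i => F.eval (a θ i)) ∈ H) ∧
      H.card ≤ 2 ^ (4 * F.sizeP P + 1) := by
  classical
  by_cases hF : F.sizeP P = 0
  · refine ⟨Finset.univ.image fun b : Bool => fun _ : ι => b, fun θ => ?_, ?_⟩
    · rcases isEmpty_or_nonempty ι with hι | ⟨⟨i₀⟩⟩
      · exact Finset.mem_image.2 ⟨true, Finset.mem_univ _, funext fun i => hι.elim i⟩
      · exact Finset.mem_image.2 ⟨F.eval (a θ i₀), Finset.mem_univ _,
          funext fun i => eval_eq_of_sizeP_eq_zero (h₁ θ i₀ i) F hF⟩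
    · refine Finset.card_image_le.trans ?_
      simp [hF]
  · obtain ⟨H, hH, hc⟩ := exists_subfunctions_unary h₁ h₂ F hF
    refine ⟨H, fun θ => hH θ id, ?_⟩
    rw [pow_succ, pow_mul]
    norm_num
    omega

end BFormula

lemma sum_two_pow_agreement {ι : Type} [Fintype ι] [DecidableEq ι] (h : ι → Bool) :
    ∑ y : ι → Bool, 2 ^ (Finset.univ.filter fun i => h i = y i).card = 3 ^ Fintype.card ι := by
  have key : ∀ y : ι → Bool, 2 ^ (Finset.univ.filter fun i => h i = y i).card
      = ∏ i, if h i = y i then 2 else 1 := by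
    intro y
    rw [Finset.prod_ite]
    simp
  simp_rw [key]
  rw [← Fintype.prod_sum (fun i (b : Bool) => if h i = b then 2 else 1)]
  have : ∀ i, (∑ b : Bool, if h i = b then 2 else 1) = 3 := by
    intro i
    cases h i <;> simp
  rw [Finset.prod_congr rfl fun i _ => this i, Finset.prod_const, Finset.card_univ]

lemma three_pow_le_two_pow (n : ℕ) : 3 ^ n ≤ 2 ^ (n + (3 * n / 5 + 1)) := by
  refine (Nat.pow_le_pow_iff_left (n := 5) (by norm_num)).1 ?_
  calc (3 ^ n) ^ 5 = 243 ^ n := by rw [← pow_mul, mul_comm, pow_mul]; norm_num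
    _ ≤ 256 ^ n := Nat.pow_le_pow_left (by norm_num) n
    _ = 2 ^ (8 * n) := by rw [pow_mul]; norm_num
    _ ≤ 2 ^ ((n + (3 * n / 5 + 1)) * 5) := Nat.pow_le_pow_right (by norm_num) (by omega)
    _ = (2 ^ (n + (3 * n / 5 + 1))) ^ 5 := by rw [pow_mul]

lemma mul_two_pow_le (m t : ℕ) : m * 2 ^ t ≤ t * 2 ^ t + 2 ^ m := by
  rcases le_total m t with h | h
  · exact (Nat.mul_le_mul_right _ h).trans (Nat.le_add_right _ _)
  · obtain ⟨d, rfl⟩ := Nat.exists_eq_add_of_le h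
    rw [add_mul, pow_add, mul_comm (2 ^ t) (2 ^ d)]
    exact Nat.add_le_add_left (Nat.mul_le_mul_right _ Nat.lt_two_pow_self.le) _

/-- If `y ↦ h y` takes few values, then `h y` agrees with `y` on average in little more than
three fifths of the positions. -/
lemma sum_agreement_le {ι : Type} [Fintype ι] [DecidableEq ι] (h : (ι → Bool) → ι → Bool)
    (H : Finset (ι → Bool)) (hH : ∀ y, h y ∈ H) (m : ℕ) (hc : H.card ≤ 2 ^ m) :
    ∑ y : ι → Bool, (Finset.univ.filter fun i => h y i = y i).card
      ≤ 2 ^ Fintype.card ι * (3 * Fintype.card ι / 5 + m + 2) := by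
  set n := Fintype.card ι
  set t := 3 * n / 5 + 1 + m with ht
  have hcard : Fintype.card (ι → Bool) = 2 ^ n := by simp [n]
  refine Nat.le_of_mul_le_mul_right (c := 2 ^ t) ?_ (Nat.two_pow_pos t)
  calc (∑ y : ι → Bool, (Finset.univ.filter fun i => h y i = y i).card) * 2 ^ t
      ≤ ∑ y : ι → Bool, (t * 2 ^ t + 2 ^ (Finset.univ.filter fun i => h y i = y i).card) := by
        rw [Finset.sum_mul]
        exact Finset.sum_le_sum fun y _ => mul_two_pow_le _ _
    _ ≤ 2 ^ n * (t * 2 ^ t)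
          + ∑ y : ι → Bool, ∑ g ∈ H, 2 ^ (Finset.univ.filter fun i => g i = y i).card := by
        rw [Finset.sum_add_distrib, Finset.sum_const, Finset.card_univ, hcard, smul_eq_mul]
        refine Nat.add_le_add_left (Finset.sum_le_sum fun y _ => ?_) _
        exact Finset.single_le_sum
          (f := fun g : ι → Bool => 2 ^ (Finset.univ.filter fun i => g i = y i).card)
          (fun _ _ => Nat.zero_le _) (hH y)
    _ = 2 ^ n * (t * 2 ^ t) + H.card * 3 ^ n := by
        rw [Finset.sum_comm]
        simp_rw [sum_two_pow_agreement]
        simp [n]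
    _ ≤ 2 ^ n * (t * 2 ^ t) + 2 ^ m * 2 ^ (n + (3 * n / 5 + 1)) :=
        Nat.add_le_add_left (Nat.mul_le_mul hc (three_pow_le_two_pow n)) _
    _ = 2 ^ n * (3 * n / 5 + m + 2) * 2 ^ t := by
        rw [ht]
        ring

/-- Expected number of leaves labeled by variables in `P`. -/
noncomputable def pmfSizeP {V : Type} (P : V → Bool) (p : PMF (BFormula V)) : ℝ≥0∞ :=
  ∑' F, p F * (F.sizeP P : ℝ≥0∞)

section StoredBit

variable {V ι : Type} {p : PMF (BFormula V)} {f : (V → Bool) → Bool} {P : V → Bool}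
  {a : (ι → Bool) → ι → V → Bool}

lemma tsum_mul_add_mul (p : PMF (BFormula V)) (c d : ℝ≥0∞) :
    ∑' F, p F * (c + d * (F.sizeP P : ℝ≥0∞)) = c + d * pmfSizeP P p := by
  simp_rw [mul_add, ENNReal.tsum_add, ENNReal.tsum_mul_right, p.tsum_coe, one_mul, pmfSizeP,
    ← ENNReal.tsum_mul_left]
  congr 1
  exact tsum_congr fun F => mul_left_comm _ _ _

lemma four_thirds_le_one_add_pmfSizeP [DecidableEq ι] [Nontrivial ι] (hp : ComputesBdd p f)
    (h₁ : ∀ y i i' v, P v = false → a y i v = a y i' v) (hf : ∀ y i, f (a y i) = y i) :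
    2 / 3 + 2 / 3 ≤ 1 + pmfSizeP P p := by
  obtain ⟨i₀, i₁, hi⟩ := exists_pair_ne ι
  let y : ι → Bool := fun i => decide (i = i₀)
  refine (add_le_add (hp (a y i₀)) (hp (a y i₁))).trans ?_
  rw [← ENNReal.tsum_add]
  refine le_of_le_of_eq (ENNReal.tsum_le_tsum fun F => ?_)
    ((tsum_mul_add_mul (P := P) p 1 1).trans (by rw [one_mul]))
  rw [one_mul, mul_add, mul_one, hf, hf]
  have hy₀ : y i₀ = true := by simp [y]
  have hy₁ : y i₁ = false := by simp [y, hi.symm]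
  rw [hy₀, hy₁]
  by_cases hF : F.sizeP P = 0
  · rw [BFormula.eval_eq_of_sizeP_eq_zero (h₁ y i₀ i₁) F hF]
    cases F.eval (a y i₁) <;> simp
  · refine add_le_add (by split_ifs <;> simp) ?_
    split_ifs
    · exact le_mul_of_one_le_right' (by exact_mod_cast Nat.one_le_iff_ne_zero.2 hF)
    · simp

lemma two_thirds_card_le [Fintype ι] [DecidableEq ι] (hp : ComputesBdd p f)
    (h₁ : ∀ y i i' v, P v = false → a y i v = a y i' v)
    (h₂ : ∀ y y' i v, P v = true → a y i v = a y' i v) (hf : ∀ y i, f (a y i) = y i) :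
    (Fintype.card ι : ℝ≥0∞) * (2 / 3)
      ≤ ((3 * Fintype.card ι / 5 + 3 : ℕ) : ℝ≥0∞) + 4 * pmfSizeP P p := by
  set n := Fintype.card ι
  have hagree : ∀ F : BFormula V,
      ∑ y : ι → Bool, (Finset.univ.filter fun i => F.eval (a y i) = y i).card
        ≤ 2 ^ n * (3 * n / 5 + 3 + 4 * F.sizeP P) := by
    intro F
    obtain ⟨H, hH, hc⟩ := F.exists_subfunctions h₁ h₂
    refine (sum_agreement_le (fun y i => F.eval (a y i)) H hH _ hc).trans (le_of_eq ?_)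
    ring
  refine (ENNReal.mul_le_mul_iff_right (a := 2 ^ n) (by simp) (by simp)).1 ?_
  calc (2 : ℝ≥0∞) ^ n * ((n : ℝ≥0∞) * (2 / 3))
      = ∑ _y : ι → Bool, ∑ _i : ι, (2 / 3 : ℝ≥0∞) := by simp [n]
    _ ≤ ∑ y : ι → Bool, ∑ i : ι, ∑' F, (if F.eval (a y i) = y i then p F else 0) := by
        refine Finset.sum_le_sum fun y _ => Finset.sum_le_sum fun i _ => ?_
        simpa only [hf] using hp (a y i)
    _ = ∑' F, p F * ((∑ y : ι → Bool,
          (Finset.univ.filter fun i => F.eval (a y i) = y i).card : ℕ) : ℝ≥0∞) := by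
        simp_rw [← Summable.tsum_finsetSum (fun _ _ => ENNReal.summable)]
        refine tsum_congr fun F => ?_
        rw [Nat.cast_sum, Finset.mul_sum]
        refine Finset.sum_congr rfl fun y _ => ?_
        rw [← Finset.sum_filter, Finset.sum_const, nsmul_eq_mul, mul_comm]
    _ ≤ ∑' F, 2 ^ n * (p F * (((3 * n / 5 + 3 : ℕ) : ℝ≥0∞) + 4 * (F.sizeP P : ℝ≥0∞))) := by
        refine ENNReal.tsum_le_tsum fun F => ?_
        rw [mul_left_comm]
        refine mul_le_mul_right ?_ _
        exact_mod_cast hagree F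
    _ = 2 ^ n * (((3 * n / 5 + 3 : ℕ) : ℝ≥0∞) + 4 * pmfSizeP P p) := by
        rw [ENNReal.tsum_mul_left, tsum_mul_add_mul]

/-- If varying the variables in `P` selects an arbitrary bit of a string stored in the other
variables, then linearly many leaves in `P` are needed. -/
lemma ofReal_card_div_le_pmfSizeP [Fintype ι] [DecidableEq ι] [Nontrivial ι]
    (hp : ComputesBdd p f) (h₁ : ∀ y i i' v, P v = false → a y i v = a y i' v)
    (h₂ : ∀ y y' i v, P v = true → a y i v = a y' i v) (hf : ∀ y i, f (a y i) = y i) :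
    ENNReal.ofReal (Fintype.card ι / 195) ≤ pmfSizeP P p := by
  have hsmall := four_thirds_le_one_add_pmfSizeP hp h₁ hf
  have hlarge := two_thirds_card_le hp h₁ h₂ hf
  rcases eq_or_ne (pmfSizeP P p) ⊤ with htop | htop
  · simp [htop]
  lift pmfSizeP P p to NNReal using htop with e
  have hthird : (2 / 3 : ℝ≥0∞) = ((2 / 3 : NNReal) : ℝ≥0∞) := by
    rw [ENNReal.coe_div (by norm_num)]
    norm_num
  rw [hthird] at hsmall hlarge
  have hs : (2 / 3 : NNReal) + 2 / 3 ≤ 1 + e := by exact_mod_cast hsmall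
  have hl : (Fintype.card ι : NNReal) * (2 / 3)
      ≤ ((3 * Fintype.card ι / 5 + 3 : ℕ) : NNReal) + 4 * e := by exact_mod_cast hlarge
  have hs' : (2 / 3 : ℝ) + 2 / 3 ≤ 1 + e := by exact_mod_cast hs
  have hl' : (Fintype.card ι : ℝ) * (2 / 3)
      ≤ ((3 * Fintype.card ι / 5 : ℕ) : ℝ) + 3 + 4 * e := by exact_mod_cast hl
  have hdiv : ((3 * Fintype.card ι / 5 : ℕ) : ℝ) ≤ 3 * Fintype.card ι / 5 := by
    exact_mod_cast Nat.cast_div_le (α := ℝ) (m := 3 * Fintype.card ι) (n := 5)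
  rw [← ENNReal.ofReal_coe_nnreal]
  exact ENNReal.ofReal_le_ofReal (by linarith)

end StoredBit

lemma BFormula.sum_sizeP_le_size {V ι : Type} (s : Finset ι) (P : ι → V → Bool)
    (hP : ∀ v, ∑ i ∈ s, (if P i v then 1 else 0) ≤ 1) (F : BFormula V) :
    ∑ i ∈ s, F.sizeP (P i) ≤ F.size := by
  induction F with
  | var v => simpa [BFormula.sizeP, BFormula.size] using hP v
  | const b => simp [BFormula.sizeP]
  | node g l r ihl ihr =>
    simp only [BFormula.size, BFormula.sizeP, Finset.sum_add_distrib] at ihl ihr ⊢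
    exact add_le_add ihl ihr

lemma sum_pmfSizeP_le_pmfSize {V ι : Type} (s : Finset ι) (P : ι → V → Bool)
    (hP : ∀ v, ∑ i ∈ s, (if P i v then 1 else 0) ≤ 1) (p : PMF (BFormula V)) :
    ∑ i ∈ s, pmfSizeP (P i) p ≤ pmfSize p := by
  unfold pmfSizeP pmfSize
  rw [← Summable.tsum_finsetSum (fun _ _ => ENNReal.summable)]
  refine ENNReal.tsum_le_tsum fun F => ?_
  rw [← Finset.mul_sum]
  refine mul_le_mul_right ?_ _
  exact_mod_cast F.sum_sizeP_le_size s P hP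

lemma binVal_testBit (m v : ℕ) (hv : v < 2 ^ m) :
    binVal m (fun i => v.testBit i) = v := by
  induction m generalizing v with
  | zero =>
    simp [binVal] at hv ⊢
    omega
  | succ m ih =>
    have ih' := ih (v / 2) (by rw [pow_succ] at hv; omega)
    unfold binVal at ih' ⊢
    rw [Fin.sum_univ_succ]
    have hstep : ∀ i : Fin m, (if v.testBit (i.succ : ℕ) then 2 ^ (i.succ : ℕ) else 0)
        = 2 * (if (v / 2).testBit i then 2 ^ (i : ℕ) else 0) := by
      intro i
      simp only [Fin.val_succ, Nat.testBit_succ, pow_succ]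
      split_ifs <;> ring
    rw [Finset.sum_congr rfl fun i _ => hstep i, ← Finset.mul_sum, ih']
    simp only [Fin.val_zero, Nat.testBit_zero, pow_zero, decide_eq_true_eq]
    split_ifs <;> omega

/-- The input with address `u`, value `v` in the `u`-th block of `X`, and storage `y`. -/
def isaInput (k j u : ℕ) (y : Fin (2 ^ k) → Bool) (v : Fin (2 ^ k)) : ISAVar k j → Bool
  | Sum.inl i => u.testBit i
  | Sum.inr (Sum.inl q) => if (q : ℕ) / k = u then (v : ℕ).testBit ((q : ℕ) % k) else false
  | Sum.inr (Sum.inr q) => y q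

/-- The variables in the `u`-th block of `X`. -/
def isaBlock (k j u : ℕ) : ISAVar k j → Bool
  | Sum.inr (Sum.inl q) => decide ((q : ℕ) / k = u)
  | _ => false

lemma ISA_isaInput {k j u : ℕ} (hk : k = 2 ^ j) (hu : u < 2 ^ (k - j)) (y : Fin (2 ^ k) → Bool)
    (v : Fin (2 ^ k)) : ISA k j (isaInput k j u y v) = y v := by
  have hjk : j ≤ k := hk ▸ Nat.lt_two_pow_self.le
  have hkpos : 0 < k := hk ▸ Nat.two_pow_pos j
  have hpow : 2 ^ (k - j) * k = 2 ^ k := by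
    conv_lhs => rw [hk, ← pow_add, ← hk]
    rw [Nat.sub_add_cancel hjk]
  have hbits : ∀ i : Fin k, isaInput k j u y v
      (Sum.inr (Sum.inl ⟨(u * k + (i : ℕ)) % 2 ^ k, Nat.mod_lt _ (Nat.two_pow_pos k)⟩))
      = (v : ℕ).testBit i := by
    intro i
    have hlt : u * k + (i : ℕ) < 2 ^ k := by
      have := Nat.mul_le_mul_right k (Nat.succ_le_of_lt hu)
      have := i.isLt
      rw [hpow, Nat.succ_mul] at *
      omega
    have hdiv : (u * k + (i : ℕ)) / k = u := by
      rw [mul_comm, Nat.mul_add_div hkpos, Nat.div_eq_of_lt i.isLt, add_zero]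
    have hmod : (u * k + (i : ℕ)) % k = i := by
      rw [mul_comm, Nat.mul_add_mod, Nat.mod_eq_of_lt i.isLt]
    simp only [isaInput, Nat.mod_eq_of_lt hlt, hdiv, hmod, if_true]
  have haddr : binVal (k - j) (fun i => isaInput k j u y v (Sum.inl i)) = u :=
    binVal_testBit _ u hu
  simp only [ISA, haddr, hbits, binVal_testBit _ _ v.isLt, Nat.mod_eq_of_lt v.isLt]
  rfl

lemma ofReal_two_pow_div_le_pmfSizeP_isaBlock {k j u : ℕ} (hk : k = 2 ^ j) (hu : u < 2 ^ (k - j))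
    {p : PMF (BFormula (ISAVar k j))} (hp : ComputesBdd p (ISA k j)) :
    ENNReal.ofReal (2 ^ k / 195) ≤ pmfSizeP (isaBlock k j u) p := by
  have hkpos : k ≠ 0 := hk ▸ (Nat.two_pow_pos j).ne'
  have : Nontrivial (Fin (2 ^ k)) := Fin.nontrivial_iff_two_le.2 (Nat.le_self_pow hkpos 2)
  have h := ofReal_card_div_le_pmfSizeP (P := isaBlock k j u) (a := isaInput k j u) hp
    (by rintro y i i' (v | v | v) hv <;> simp_all [isaInput, isaBlock])
    (by rintro y y' i (v | v | v) hv <;> simp_all [isaInput, isaBlock])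
    (fun y v => ISA_isaInput hk hu y v)
  simpa using h

/-- Every strong probabilistic formula computing `ISA_n` with bounded error has
size at least `c·n²/log₂ n`, for `n = 2^k` with `k ≥ 2` a power of two. -/
theorem stmt2 :
    ∃ c : ℝ, 0 < c ∧
      ∀ k j : ℕ, k = 2 ^ j → 2 ≤ k →
        ∀ p : PMF (BFormula (ISAVar k j)), ComputesBdd p (ISA k j) →
          ENNReal.ofReal (c * ((2 ^ k : ℝ) ^ 2 / (k : ℝ))) ≤ pmfSize p := by
  refine ⟨1 / 195, by norm_num, fun k j hk _ p hp => ?_⟩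
  have hjk : j ≤ k := hk ▸ Nat.lt_two_pow_self.le
  have hk0 : (k : ℝ) ≠ 0 := by
    rw [hk]
    positivity
  have hpow : (2 : ℝ) ^ (k - j) * k = 2 ^ k := by
    have hcast : (k : ℝ) = 2 ^ j := by exact_mod_cast hk
    rw [hcast, ← pow_add, Nat.sub_add_cancel hjk]
  calc ENNReal.ofReal (1 / 195 * ((2 ^ k : ℝ) ^ 2 / (k : ℝ)))
      = ∑ _u ∈ Finset.range (2 ^ (k - j)), ENNReal.ofReal (2 ^ k / 195) := by
        rw [Finset.sum_const, Finset.card_range, ← ENNReal.ofReal_nsmul, nsmul_eq_mul]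
        congr 1
        push_cast
        rw [sq]
        nth_rewrite 1 [← hpow]
        field_simp
    _ ≤ ∑ u ∈ Finset.range (2 ^ (k - j)), pmfSizeP (isaBlock k j u) p :=
        Finset.sum_le_sum fun u hu =>
          ofReal_two_pow_div_le_pmfSizeP_isaBlock hk (Finset.mem_range.1 hu) hp
    _ ≤ pmfSize p := by
        refine sum_pmfSizeP_le_pmfSize _ _ (fun v => ?_) p
        rcases v with v | v | v
        · simp [isaBlock]
        · simp only [isaBlock, decide_eq_true_eq, Finset.sum_ite_eq]
          split_ifs <;> simp
        · simp [isaBlock]
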